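/- Let N, n ∈ ℕ, p ≥ 2, i ∈ {1,…,N}^p, c ∈ ℝ, and let H₀ : Σ_N → ℝ be any Hamiltonian. For x ∈ ℝ define H_x(σ) = H₀(σ) + c·x·σ_i. Then for every F : Σ_N^n → ℝ the map x ↦ ⟨F⟩_{H_x} is infinitely differentiable, and for every j ∈ ℕ its j-th derivative satisfies d^j/dx^j ⟨F⟩_{H_x} = c^j · ⟨D_i^j F⟩_{H_x}. -/

import Mathlib

open Filter

noncomputable section

/-- The configuration space `Σ_N = {-1,1}^N`, encoded by booleans. -/
abbrev Spin (N : ℕ) := Fin N → Bool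

/-- The real spin value `σ_i ∈ {-1,1}` at site `i`. -/
def spin {N : ℕ} (σ : Spin N) (i : Fin N) : ℝ := if σ i then 1 else -1

/-- For `i = (i₁,…,i_p)`, the product `σ_i = σ_{i₁} ⋯ σ_{i_p}`. -/
def spinProd {N p : ℕ} (σ : Spin N) (i : Fin p → Fin N) : ℝ := ∏ j, spin σ (i j)

/-- The partition function `Z(H)`. -/
def partitionZ {N : ℕ} (H : Spin N → ℝ) : ℝ := ∑ τ : Spin N, Real.exp (H τ)

/-- The Gibbs measure `G_H({σ}) = e^{H(σ)}/Z(H)`. -/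
def gibbs {N : ℕ} (H : Spin N → ℝ) (σ : Spin N) : ℝ := Real.exp (H σ) / partitionZ H

/-- The Gibbs expectation `⟨F⟩_H` of a function of `n` replicas. -/
def gibbsExp {N n : ℕ} (H : Spin N → ℝ) (F : (Fin n → Spin N) → ℝ) : ℝ :=
  ∑ σ : Fin n → Spin N, F σ * ∏ ℓ, gibbs H (σ ℓ)

/-- The multiplication operator `D_i` of (2.1):
`D_i F(σ¹,…,σ^{n+1}) = (∑_{ℓ=1}^n σ_i^ℓ - n σ_i^{n+1}) F(σ¹,…,σⁿ)`. -/
def Dop {N p : ℕ} (i : Fin p → Fin N) {n : ℕ} (F : (Fin n → Spin N) → ℝ)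
    (σ : Fin (n + 1) → Spin N) : ℝ :=
  ((∑ ℓ : Fin n, spinProd (σ ℓ.castSucc) i) - n * spinProd (σ (Fin.last n)) i) *
    F fun ℓ => σ ℓ.castSucc

/-- The `m`-fold iterate `D_i^m F`, a function of `n + m` replicas. -/
def DopIter {N p : ℕ} (i : Fin p → Fin N) {n : ℕ} :
    (m : ℕ) → ((Fin n → Spin N) → ℝ) → (Fin (n + m) → Spin N) → ℝ
  | 0, F => F
  | m + 1, F => Dop i (DopIter i m F)

/-- Extension of a finite replica family to an infinite one (junk beyond index `r`). -/
def extendReplicas {N r : ℕ} (σ : Fin r → Spin N) : ℕ → Spin N :=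
  fun j => if hj : j < r then σ ⟨j, hj⟩ else fun _ => true

/-- The functions `S_i^{m,n}` of (4.1), for an integer superscript `m` (zero if `m ≤ 0`):
`S_i^{m,n} = m! ∑_{k=0}^m (-1)^{m-k} C(n+m-k-1, n-1)
  ∑_{1≤ℓ₁<⋯<ℓ_k≤n} σ_i^{ℓ₁}⋯σ_i^{ℓ_k} σ_i^{n+1}⋯σ_i^{n+m-k}`. -/
def Sfun {N p : ℕ} (i : Fin p → Fin N) (n : ℕ) (m : ℤ) (σ : ℕ → Spin N) : ℝ :=
  if 1 ≤ m then
    (Nat.factorial m.toNat : ℝ) * ∑ k ∈ Finset.range (m.toNat + 1),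
      (-1 : ℝ) ^ (m.toNat - k) * (Nat.choose (n + m.toNat - k - 1) (n - 1) : ℝ) *
        ∑ T ∈ Finset.powersetCard k (Finset.univ : Finset (Fin n)),
          (∏ ℓ ∈ T, spinProd (σ (ℓ : ℕ)) i) *
            ∏ j ∈ Finset.Ico n (n + m.toNat - k), spinProd (σ j) i
  else 0

/-- The integer array `A(m,a)` defined recursively by `A(m,0) = 0`, `A(1,a) = 1_{a=1}` and
`A(m+1,a) = -(m-2a+4)(m-2a+3) A(m,a-1) + A(m,a)` for `m, a ≥ 1`. -/
def Aarr : ℕ → ℕ → ℤ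
  | _, 0 => 0
  | 0, _ + 1 => 0
  | 1, a + 1 => if a = 0 then 1 else 0
  | m + 2, a + 1 =>
      -(((m : ℤ) + 1) - 2 * ((a : ℤ) + 1) + 4) * (((m : ℤ) + 1) - 2 * ((a : ℤ) + 1) + 3)
          * Aarr (m + 1) a + Aarr (m + 1) (a + 1)

section GibbsDerivative

variable {N : ℕ}

theorem partitionZ_pos (H : Spin N → ℝ) : 0 < partitionZ H :=
  Finset.sum_pos (fun _ _ => Real.exp_pos _) Finset.univ_nonempty

theorem sum_gibbs (H : Spin N → ℝ) : ∑ τ, gibbs H τ = 1 := by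
  simp only [gibbs, ← Finset.sum_div]
  exact div_self (partitionZ_pos H).ne'

theorem gibbsExp_eq_sum_castSucc_last {n : ℕ} (H : Spin N → ℝ)
    (F : (Fin (n + 1) → Spin N) → ℝ) :
    gibbsExp H F = ∑ σ : Fin n → Spin N, ∑ τ : Spin N,
      F (Fin.snoc (α := fun _ => Spin N) σ τ) * ((∏ ℓ, gibbs H (σ ℓ)) * gibbs H τ) := by
  unfold gibbsExp
  rw [← (Fin.snocEquiv fun _ : Fin (n + 1) => Spin N).sum_comp, Fintype.sum_prod_type,
    Finset.sum_comm]
  simp [Fin.snocEquiv, Fin.prod_univ_castSucc]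

/-- Averaging out the additional replica in `D_i F`. -/
theorem gibbsExp_Dop {n p : ℕ} (H : Spin N → ℝ) (i : Fin p → Fin N)
    (F : (Fin n → Spin N) → ℝ) :
    gibbsExp H (Dop i F) = ∑ σ : Fin n → Spin N,
      F σ * ((∑ ℓ, (spinProd (σ ℓ) i - ∑ τ, spinProd τ i * gibbs H τ)) *
        ∏ ℓ, gibbs H (σ ℓ)) := by
  rw [gibbsExp_eq_sum_castSucc_last]
  refine Finset.sum_congr rfl fun σ _ => ?_
  simp only [Dop, Fin.snoc_castSucc, Fin.snoc_last, Finset.sum_sub_distrib, Finset.sum_const,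
    Finset.card_univ, Fintype.card_fin, nsmul_eq_mul]
  set A := ∑ ℓ, spinProd (σ ℓ) i
  set P := ∏ ℓ, gibbs H (σ ℓ)
  calc ∑ τ, (A - n * spinProd τ i) * F σ * (P * gibbs H τ)
      = ∑ τ, (A * F σ * P * gibbs H τ - n * F σ * P * (spinProd τ i * gibbs H τ)) :=
        Finset.sum_congr rfl fun τ _ => by ring
    _ = A * F σ * P - n * F σ * P * ∑ τ, spinProd τ i * gibbs H τ := by
        rw [Finset.sum_sub_distrib, ← Finset.mul_sum, ← Finset.mul_sum, sum_gibbs, mul_one]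
    _ = _ := by ring

theorem hasDerivAt_gibbs (H₀ s : Spin N → ℝ) (c x : ℝ) (σ : Spin N) :
    HasDerivAt (fun y : ℝ => gibbs (fun τ => H₀ τ + c * y * s τ) σ)
      (c * (s σ - ∑ τ, s τ * gibbs (fun τ => H₀ τ + c * x * s τ) τ) *
        gibbs (fun τ => H₀ τ + c * x * s τ) σ) x := by
  have hexp (τ : Spin N) : HasDerivAt (fun y : ℝ => Real.exp (H₀ τ + c * y * s τ))
      (Real.exp (H₀ τ + c * x * s τ) * (c * s τ)) x := by
    simpa using ((((hasDerivAt_id x).const_mul c).mul_const (s τ)).const_add (H₀ τ)).exp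
  have hZ : HasDerivAt (fun y : ℝ => partitionZ fun τ => H₀ τ + c * y * s τ)
      (∑ τ, Real.exp (H₀ τ + c * x * s τ) * (c * s τ)) x :=
    HasDerivAt.fun_sum fun τ _ => hexp τ
  have hpos := (partitionZ_pos fun τ => H₀ τ + c * x * s τ).ne'
  refine ((hexp σ).fun_div hZ hpos).congr_deriv ?_
  have hsum : ∑ τ, Real.exp (H₀ τ + c * x * s τ) * (c * s τ) =
      c * (∑ τ, s τ * gibbs (fun τ => H₀ τ + c * x * s τ) τ) *
        partitionZ fun τ => H₀ τ + c * x * s τ := by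
    rw [Finset.mul_sum, Finset.sum_mul]
    refine Finset.sum_congr rfl fun τ _ => ?_
    unfold gibbs
    field_simp
  rw [hsum]
  generalize ∑ τ, s τ * gibbs (fun τ => H₀ τ + c * x * s τ) τ = m
  unfold gibbs
  field_simp

theorem hasDerivAt_gibbsExp {n p : ℕ} (i : Fin p → Fin N) (c : ℝ) (H₀ : Spin N → ℝ)
    (F : (Fin n → Spin N) → ℝ) (x : ℝ) :
    HasDerivAt (fun y : ℝ => gibbsExp (fun σ => H₀ σ + c * y * spinProd σ i) F)
      (c * gibbsExp (fun σ => H₀ σ + c * x * spinProd σ i) (Dop i F)) x := by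
  have h := HasDerivAt.fun_sum (u := (Finset.univ : Finset (Fin n → Spin N))) fun σ _ =>
    (HasDerivAt.fun_finsetProd (u := (Finset.univ : Finset (Fin n))) fun ℓ _ =>
      hasDerivAt_gibbs H₀ (fun τ => spinProd τ i) c x (σ ℓ)).const_mul (F σ)
  refine h.congr_deriv ?_
  rw [gibbsExp_Dop, Finset.mul_sum]
  refine Finset.sum_congr rfl fun σ _ => ?_
  rw [mul_left_comm c]
  congr 1
  rw [Finset.sum_mul, Finset.mul_sum]
  refine Finset.sum_congr rfl fun ℓ _ => ?_
  rw [← Finset.prod_erase_mul _ _ (Finset.mem_univ ℓ), smul_eq_mul]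
  ring

theorem iteratedDeriv_gibbsExp {n p : ℕ} (i : Fin p → Fin N) (c : ℝ) (H₀ : Spin N → ℝ)
    (F : (Fin n → Spin N) → ℝ) (j : ℕ) :
    iteratedDeriv j (fun y : ℝ => gibbsExp (fun σ => H₀ σ + c * y * spinProd σ i) F) =
      fun x => c ^ j * gibbsExp (fun σ => H₀ σ + c * x * spinProd σ i) (DopIter i j F) := by
  induction j with
  | zero => simp [DopIter]
  | succ j ih =>
    rw [iteratedDeriv_succ, ih]
    funext x
    rw [((hasDerivAt_gibbsExp i c H₀ (DopIter i j F) x).const_mul (c ^ j)).deriv, ← mul_assoc,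
      ← pow_succ]
    rfl

end GibbsDerivative

/-- The differentiation identity (2.6): with `H_x(σ) = H₀(σ) + c x σ_i`, the map
`x ↦ ⟨F⟩_{H_x}` is infinitely differentiable and its `j`-th derivative equals
`c^j ⟨D_i^j F⟩_{H_x}`. -/
theorem gibbsExp_deriv_eq {N n p : ℕ} (hn : 1 ≤ n) (hp : 2 ≤ p)
    (i : Fin p → Fin N) (c : ℝ) (H₀ : Spin N → ℝ) (F : (Fin n → Spin N) → ℝ) :
    ContDiff ℝ (⊤ : ℕ∞) (fun x : ℝ => gibbsExp (fun σ => H₀ σ + c * x * spinProd σ i) F) ∧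
    ∀ (j : ℕ) (x : ℝ),
      iteratedDeriv j (fun y : ℝ => gibbsExp (fun σ => H₀ σ + c * y * spinProd σ i) F) x
        = c ^ j * gibbsExp (fun σ => H₀ σ + c * x * spinProd σ i) (DopIter i j F) := by
  refine ⟨contDiff_of_differentiable_iteratedDeriv fun j _ => ?_,
    fun j => congrFun (iteratedDeriv_gibbsExp i c H₀ F j)⟩
  rw [iteratedDeriv_gibbsExp]
  exact fun x =>
    ((hasDerivAt_gibbsExp i c H₀ (DopIter i j F) x).const_mul (c ^ j)).differentiableAt
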